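/- Let λ ≥ 0. Assume L̄|[0,+∞) is proper and L̄(t) < +∞ for some t > λ. Then there exists ε > 0 such that l₀(L̄'_r(t)) = L̄*(L̄'_r(t)) for every t ∈ (λ, λ+ε). Moreover, when L̄'_r(λ⁺) ≠ −∞, also l₀(L̄'_r(λ⁺)) = L̄*(L̄'_r(λ⁺)). -/

import Mathlib

open Filter MeasureTheory Set Topology

noncomputable section

/-- `c · log m` as an extended real number, where `m ∈ [0,∞]`. -/
def elog (c : ℝ) (m : ENNReal) : EReal := (c : EReal) * ENNReal.log m

/-- The generalized log-moment generating function `L̄` associated with the net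
`(μ_α, c_α)` indexed by the filter `lf`:
`L̄(t) = limsup_α c_α · log ∫ exp(t·x/c_α) dμ_α(x)`. -/
def genLogMGF {ι : Type*} (lf : Filter ι) (μ : ι → Measure ℝ) (c : ι → ℝ) (t : ℝ) : EReal :=
  Filter.limsup
    (fun i => elog (c i) (∫⁻ x : ℝ, ENNReal.ofReal (Real.exp (t * x / c i)) ∂ (μ i))) lf

/-- Legendre–Fenchel transform of an `EReal`-valued function on `ℝ`, evaluated at an
extended real argument: `L*(x) = sup_t (t·x − L(t))`. -/
def LegendreEE (L : ℝ → EReal) (x : EReal) : EReal := ⨆ t : ℝ, ((t : EReal) * x - L t)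

open Classical in
/-- The right derivative of a convex `EReal`-valued function at `t`, with the conventions
`L'_r(t) = +∞` when `L(s) = +∞` for all `s > t` and `L'_r(t) = -∞` when `L(s) = -∞` for
some `s > t`; otherwise it is the infimum of the right difference quotients. -/
def rightDerivE (L : ℝ → EReal) (t : ℝ) : EReal :=
  if ∀ s : ℝ, t < s → L s = ⊤ then ⊤
  else if ∃ s : ℝ, t < s ∧ L s = ⊥ then ⊥
  else ⨅ s ∈ Set.Ioi t, (L s - L t) * (((s - t)⁻¹ : ℝ) : EReal)

/-- The left derivative of a convex `EReal`-valued function at `t` (supremum of left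
difference quotients). -/
def leftDerivE (L : ℝ → EReal) (t : ℝ) : EReal :=
  ⨆ s ∈ Set.Iio t, (L t - L s) * (((t - s)⁻¹ : ℝ) : EReal)

/-- Right limit at `a` of an `EReal`-valued function (as a `limsup`; it coincides with
`lim_{t→a⁺} f(t)` whenever the latter exists, e.g. for monotone or convex `f`). -/
def rightLimE (f : ℝ → EReal) (a : ℝ) : EReal := Filter.limsup f (nhdsWithin a (Set.Ioi a))

/-- Left limit at `a` of an `EReal`-valued function (as a `limsup`; it coincides with
`lim_{t→a⁻} f(t)` whenever the latter exists). -/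
def leftLimE (f : ℝ → EReal) (a : ℝ) : EReal := Filter.limsup f (nhdsWithin a (Set.Iio a))

/-- `L` is affine on the interval `(a, b]`. -/
def AffineOnIoc (L : ℝ → EReal) (a b : ℝ) : Prop :=
  ∃ p q : ℝ, ∀ s ∈ Set.Ioc a b, L s = ((p * s + q : ℝ) : EReal)

/-- `λ̃ = sup {t > λ : L is affine on (λ, t]}` (equal to `λ` if there is no such `t`). -/
def tildeOf (L : ℝ → EReal) (lam : ℝ) : ℝ :=
  sSup (insert lam {t : ℝ | lam < t ∧ AffineOnIoc L lam t})

/-- Differentiability at `t` of an `EReal`-valued function: `L(t)` is finite and the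
difference quotients converge to a (finite) real number. -/
def EDifferentiableAt (L : ℝ → EReal) (t : ℝ) : Prop :=
  (∃ r : ℝ, L t = (r : EReal)) ∧
  ∃ d : ℝ, Filter.Tendsto (fun s => (L s - L t) * (((s - t)⁻¹ : ℝ) : EReal))
    (nhdsWithin t {t}ᶜ) (nhds (d : EReal))

/-- The function `l₀(x) = − lim_{ε→0⁺} limsup_α c_α · log μ_α((x−ε, x+ε))` (the limit over
`ε` exists by monotonicity and equals the infimum). -/
def l0fun {ι : Type*} (lf : Filter ι) (μ : ι → Measure ℝ) (c : ι → ℝ) (x : ℝ) : EReal :=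
  - ⨅ ε ∈ Set.Ioi (0:ℝ),
      Filter.limsup (fun i => elog (c i) (μ i (Set.Ioo (x - ε) (x + ε)))) lf

/-- `L` restricted to `[0,∞)` is proper: `(−∞,+∞]`-valued with at least one finite value. -/
def LbarProper (L : ℝ → EReal) : Prop :=
  (∀ t : ℝ, 0 ≤ t → L t ≠ ⊥) ∧ ∃ t : ℝ, 0 ≤ t ∧ L t ≠ ⊤

/-- `μ([x, y])` for extended-real endpoints `x, y`, with `μ` regarded as a measure on
`[-∞, +∞]`. -/
def muIccE (μ : Measure ℝ) (x y : EReal) : ENNReal :=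
  μ {z : ℝ | x ≤ (z : EReal) ∧ (z : EReal) ≤ y}

/-- `μ((x, y))` for extended-real endpoints `x, y`. -/
def muIooE (μ : Measure ℝ) (x y : EReal) : ENNReal :=
  μ {z : ℝ | x < (z : EReal) ∧ (z : EReal) < y}

open Classical in
/-- The Legendre transform extended to `[-∞,+∞]` by continuity, with the paper's
convention `L̄*(−∞) = −L̄(0⁺)`. -/
def LegendreExt (L : ℝ → EReal) (x : EReal) : EReal :=
  if x = ⊥ then -(rightLimE L 0) else if x = ⊤ then ⊤ else LegendreEE L x

end

lemma elog_le_coe_iff {c : ℝ} (hc : 0 < c) (m : ENNReal) (A : ℝ) :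
    elog c m ≤ (A : EReal) ↔ m ≤ ENNReal.ofReal (Real.exp (A / c)) := by
  have h : (A : EReal) / (c : EReal) = ((A / c : ℝ) : EReal) := (EReal.coe_div A c).symm
  rw [elog, mul_comm, ← EReal.le_div_iff_mul_le (by exact_mod_cast hc) (EReal.coe_ne_top c), h,
    ← EReal.exp_coe, ← ENNReal.log_le_log_iff, EReal.log_exp]

lemma lintegral_exp_add_le_iff (ν : Measure ℝ) (c s k G : ℝ) :
    ∫⁻ y : ℝ, ENNReal.ofReal (Real.exp ((s * y + k) / c)) ∂ν ≤ ENNReal.ofReal (Real.exp (G / c)) ↔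
      ∫⁻ y : ℝ, ENNReal.ofReal (Real.exp (s * y / c)) ∂ν
        ≤ ENNReal.ofReal (Real.exp ((G - k) / c)) := by
  have hk : ENNReal.ofReal (Real.exp (k / c)) ≠ 0 := by simp [Real.exp_pos]
  have h1 : ∫⁻ y : ℝ, ENNReal.ofReal (Real.exp ((s * y + k) / c)) ∂ν
      = ENNReal.ofReal (Real.exp (k / c))
        * ∫⁻ y : ℝ, ENNReal.ofReal (Real.exp (s * y / c)) ∂ν := by
    rw [← lintegral_const_mul _ (by fun_prop)]
    congr 1 with y
    rw [← ENNReal.ofReal_mul (Real.exp_pos _).le, ← Real.exp_add]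
    ring_nf
  have h2 : ENNReal.ofReal (Real.exp (G / c)) = ENNReal.ofReal (Real.exp (k / c))
      * ENNReal.ofReal (Real.exp ((G - k) / c)) := by
    rw [← ENNReal.ofReal_mul (Real.exp_pos _).le, ← Real.exp_add]
    ring_nf
  rw [h1, h2, ENNReal.mul_le_mul_iff_right hk ENNReal.ofReal_ne_top]

section Limsup

variable {ι : Type*} {lf : Filter ι} {μ : ι → Measure ℝ} {c : ι → ℝ}

lemma limsup_elog_le (hc : ∀ i, 0 < c i) {m : ι → ENNReal} {A : ℝ}
    (h : ∀ᶠ i in lf, m i ≤ ENNReal.ofReal (Real.exp (A / c i))) :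
    limsup (fun i => elog (c i) (m i)) lf ≤ (A : EReal) :=
  limsup_le_of_le (h := h.mono fun i hi => (elog_le_coe_iff (hc i) _ _).2 hi)

lemma eventually_le_exp_of_limsup_elog_lt (hc : ∀ i, 0 < c i) {m : ι → ENNReal} {A : ℝ}
    (h : limsup (fun i => elog (c i) (m i)) lf < (A : EReal)) :
    ∀ᶠ i in lf, m i ≤ ENNReal.ofReal (Real.exp (A / c i)) :=
  (eventually_lt_of_limsup_lt h).mono fun i hi => (elog_le_coe_iff (hc i) _ _).1 hi.le

lemma eventually_lintegral_exp_add_le (hc : ∀ i, 0 < c i) {s k G : ℝ}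
    (h : genLogMGF lf μ c s < ((G - k : ℝ) : EReal)) :
    ∀ᶠ i in lf, ∫⁻ y : ℝ, ENNReal.ofReal (Real.exp ((s * y + k) / c i)) ∂(μ i)
      ≤ ENNReal.ofReal (Real.exp (G / c i)) :=
  (eventually_le_exp_of_limsup_elog_lt hc h).mono
    fun i hi => (lintegral_exp_add_le_iff (μ i) (c i) s k G).2 hi

lemma genLogMGF_zero [lf.NeBot] [∀ i, IsProbabilityMeasure (μ i)] : genLogMGF lf μ c 0 = 0 := by
  simp [genLogMGF, elog]

lemma genLogMGF_convexComb_le (hc : ∀ i, 0 < c i) {a d w v A D : ℝ} (hw : 0 ≤ w) (hv : 0 ≤ v)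
    (hwv : w + v = 1) (hA : genLogMGF lf μ c a < (A : EReal))
    (hD : genLogMGF lf μ c d < (D : EReal)) :
    genLogMGF lf μ c (w * a + v * d) ≤ ((w * A + v * D : ℝ) : EReal) := by
  refine limsup_elog_le hc ?_
  filter_upwards [eventually_lintegral_exp_add_le (k := -A) (G := 0) hc (by simpa using hA),
    eventually_lintegral_exp_add_le (k := -D) (G := 0) hc (by simpa using hD)] with i hi hi'
  have key := lintegral_exp_add_le_iff (μ i) (c i) (w * a + v * d) (-(w * A + v * D)) 0
  rw [zero_sub, neg_neg] at key
  rw [← key]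
  calc ∫⁻ y : ℝ, ENNReal.ofReal
        (Real.exp (((w * a + v * d) * y + -(w * A + v * D)) / c i)) ∂(μ i)
      ≤ ∫⁻ y : ℝ, (ENNReal.ofReal w * ENNReal.ofReal (Real.exp ((a * y + -A) / c i))
        + ENNReal.ofReal v * ENNReal.ofReal (Real.exp ((d * y + -D) / c i))) ∂(μ i) := by
        refine lintegral_mono fun y => ?_
        rw [← ENNReal.ofReal_mul hw, ← ENNReal.ofReal_mul hv,
          ← ENNReal.ofReal_add (by positivity) (by positivity)]
        refine ENNReal.ofReal_le_ofReal ?_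
        have := convexOn_exp.2 (mem_univ ((a * y + -A) / c i)) (mem_univ ((d * y + -D) / c i))
          hw hv hwv
        simp only [smul_eq_mul] at this
        refine le_trans (le_of_eq ?_) this
        ring_nf
    _ = ENNReal.ofReal w * ∫⁻ y : ℝ, ENNReal.ofReal (Real.exp ((a * y + -A) / c i)) ∂(μ i)
        + ENNReal.ofReal v
          * ∫⁻ y : ℝ, ENNReal.ofReal (Real.exp ((d * y + -D) / c i)) ∂(μ i) := by
        rw [lintegral_add_left (by fun_prop), lintegral_const_mul _ (by fun_prop),
          lintegral_const_mul _ (by fun_prop)]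
    _ ≤ ENNReal.ofReal w * ENNReal.ofReal (Real.exp (0 / c i))
        + ENNReal.ofReal v * ENNReal.ofReal (Real.exp (0 / c i)) := by gcongr
    _ = ENNReal.ofReal (Real.exp (0 / c i)) := by
        rw [← add_mul, ← ENNReal.ofReal_add hw hv, hwv]
        simp

lemma genLogMGF_le_chord (hc : ∀ i, 0 < c i) {a b d A D : ℝ} (hab : a < b) (hbd : b < d)
    (hA : genLogMGF lf μ c a ≤ (A : EReal)) (hD : genLogMGF lf μ c d ≤ (D : EReal)) :
    genLogMGF lf μ c b ≤ ((((d - b) * A + (b - a) * D) / (d - a) : ℝ) : EReal) := by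
  have hda : 0 < d - a := by linarith
  refine EReal.le_of_forall_lt_iff_le.1 fun z hz => ?_
  rw [EReal.coe_lt_coe_iff] at hz
  set η := z - ((d - b) * A + (b - a) * D) / (d - a) with hη
  have hη0 : 0 < η := by simp only [hη]; linarith
  have h := genLogMGF_convexComb_le (lf := lf) (μ := μ) hc (a := a) (d := d)
    (w := (d - b) / (d - a)) (v := (b - a) / (d - a)) (A := A + η) (D := D + η)
    (div_nonneg (by linarith) hda.le) (div_nonneg (by linarith) hda.le)
    (by field_simp; ring)
    (hA.trans_lt (by exact_mod_cast (by linarith : A < A + η)))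
    (hD.trans_lt (by exact_mod_cast (by linarith : D < D + η)))
  have e1 : (d - b) / (d - a) * a + (b - a) / (d - a) * d = b := by field_simp; ring
  have e2 : (d - b) / (d - a) * (A + η) + (b - a) / (d - a) * (D + η) = z := by
    have : (d - b) / (d - a) * (A + η) + (b - a) / (d - a) * (D + η)
      = ((d - b) * A + (b - a) * D) / (d - a) + η := by field_simp; ring
    rw [this, hη]; ring
  rwa [e1, e2] at h

lemma limsup_elog_Ioo_le (hc : ∀ i, 0 < c i) {t x δ A : ℝ}
    (hA : genLogMGF lf μ c t < (A : EReal)) :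
    limsup (fun i => elog (c i) (μ i (Ioo (x - δ) (x + δ)))) lf
      ≤ ((A - t * x + |t| * δ : ℝ) : EReal) := by
  refine limsup_elog_le hc ?_
  filter_upwards [eventually_lintegral_exp_add_le (k := -(t * x) + |t| * δ)
    (G := A - t * x + |t| * δ) hc (by convert hA using 2; ring)] with i hi
  refine le_trans ?_ hi
  rw [← lintegral_indicator_one measurableSet_Ioo]
  refine lintegral_mono fun y => ?_
  rw [indicator_apply]
  split_ifs with hy
  swap
  · simp
  rw [Pi.one_apply, ENNReal.one_le_ofReal, Real.one_le_exp_iff]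
  refine div_nonneg ?_ (hc i).le
  have h1 : |y - x| ≤ δ := abs_le.2 ⟨by linarith [hy.1], by linarith [hy.2]⟩
  have h2 : |t * (y - x)| ≤ |t| * δ := by
    rw [abs_mul]; exact mul_le_mul_of_nonneg_left h1 (abs_nonneg t)
  linarith [(abs_le.1 h2).1]

lemma le_limsup_elog_Ioo [lf.NeBot] (hc : ∀ i, 0 < c i) (hc0 : Tendsto c lf (𝓝 0))
    {t x δ F s₁ s₂ : ℝ} (ht : 0 ≤ t) (hF : genLogMGF lf μ c t = (F : EReal))
    (hs₁ : t < s₁) (hL₁ : genLogMGF lf μ c s₁ < ((F + (s₁ - t) * (x + δ) : ℝ) : EReal))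
    (hs₂ : s₂ < t) (hL₂ : genLogMGF lf μ c s₂ < ((F - (t - s₂) * (x - δ) : ℝ) : EReal)) :
    ((F - t * x - t * δ : ℝ) : EReal)
      ≤ limsup (fun i => elog (c i) (μ i (Ioo (x - δ) (x + δ)))) lf := by
  by_contra! hlt
  obtain ⟨q₀, h0, h0'⟩ := EReal.lt_iff_exists_real_btwn.1 hlt
  obtain ⟨q₁, h1, h1'⟩ := EReal.lt_iff_exists_real_btwn.1 hL₁
  obtain ⟨q₂, h2, h2'⟩ := EReal.lt_iff_exists_real_btwn.1 hL₂
  rw [EReal.coe_lt_coe_iff] at h0' h1' h2'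
  obtain ⟨G, hG, hGF⟩ : ∃ G, max (q₀ + t * (x + δ))
      (max (q₁ - (s₁ - t) * (x + δ)) (q₂ + (t - s₂) * (x - δ))) < G ∧ G < F :=
    exists_between (by
      refine max_lt ?_ (max_lt ?_ ?_) <;> linarith)
  obtain ⟨hG0, hG'⟩ := max_lt_iff.1 hG
  obtain ⟨hG1, hG2⟩ := max_lt_iff.1 hG'
  obtain ⟨G', hGG', hG'F⟩ := exists_between hGF
  have hlog : 0 < Real.log 3 := Real.log_pos (by norm_num)
  have e0 := eventually_le_exp_of_limsup_elog_lt hc (A := G - t * (x + δ))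
    (h0.trans (by exact_mod_cast (by linarith)))
  have e1 := eventually_lintegral_exp_add_le (lf := lf) (μ := μ) hc (s := s₁) (G := G)
    (k := -((s₁ - t) * (x + δ))) (h1.trans (by exact_mod_cast (by linarith)))
  have e2 := eventually_lintegral_exp_add_le (lf := lf) (μ := μ) hc (s := s₂) (G := G)
    (k := (t - s₂) * (x - δ)) (h2.trans (by exact_mod_cast (by linarith)))
  have e3 : ∀ᶠ i in lf, c i < (G' - G) / Real.log 3 :=
    hc0.eventually_lt_const (div_pos (by linarith) hlog)
  have hle : genLogMGF lf μ c t ≤ (G' : EReal) := by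
    refine limsup_elog_le hc ?_
    filter_upwards [e0, e1, e2, e3] with i h0 h1 h2 h3
    have hci := hc i
    have hB : ∫⁻ y : ℝ, (Ioo (x - δ) (x + δ)).indicator
        (fun _ => ENNReal.ofReal (Real.exp (t * (x + δ) / c i))) y ∂(μ i)
        ≤ ENNReal.ofReal (Real.exp (G / c i)) := by
      rw [lintegral_indicator_const measurableSet_Ioo]
      refine (mul_le_mul_right h0 _).trans (le_of_eq ?_)
      rw [← ENNReal.ofReal_mul (Real.exp_pos _).le, ← Real.exp_add]
      ring_nf
    calc ∫⁻ y : ℝ, ENNReal.ofReal (Real.exp (t * y / c i)) ∂(μ i)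
        ≤ ∫⁻ y : ℝ, ((Ioo (x - δ) (x + δ)).indicator
            (fun _ => ENNReal.ofReal (Real.exp (t * (x + δ) / c i))) y
          + (ENNReal.ofReal (Real.exp ((s₁ * y + -((s₁ - t) * (x + δ))) / c i))
          + ENNReal.ofReal (Real.exp ((s₂ * y + (t - s₂) * (x - δ)) / c i)))) ∂(μ i) := by
          refine lintegral_mono fun y => ?_
          rcases le_or_gt (x + δ) y with hy | hy
          · refine le_trans (ENNReal.ofReal_le_ofReal ?_) (le_self_add.trans le_add_self)
            gcongr
            nlinarith
          rcases le_or_gt y (x - δ) with hy' | hy'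
          · refine le_trans (ENNReal.ofReal_le_ofReal ?_) (le_add_self.trans le_add_self)
            gcongr
            nlinarith
          · refine le_trans ?_ le_self_add
            rw [indicator_of_mem (show y ∈ Ioo (x - δ) (x + δ) from ⟨hy', hy⟩)]
            gcongr
      _ ≤ ENNReal.ofReal (Real.exp (G / c i)) + (ENNReal.ofReal (Real.exp (G / c i))
          + ENNReal.ofReal (Real.exp (G / c i))) := by
          rw [lintegral_add_right _ (by fun_prop), lintegral_add_right _ (by fun_prop)]
          gcongr
      _ ≤ ENNReal.ofReal (Real.exp (G' / c i)) := by
          rw [← ENNReal.ofReal_add (by positivity) (by positivity),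
            ← ENNReal.ofReal_add (by positivity) (by positivity)]
          refine ENNReal.ofReal_le_ofReal ?_
          have h3' : Real.log 3 ≤ (G' - G) / c i := by
            rw [lt_div_iff₀ hlog] at h3
            rw [le_div_iff₀ hci]
            linarith
          calc _ = Real.exp (Real.log 3) * Real.exp (G / c i) := by
                rw [Real.exp_log (by norm_num)]; ring
            _ ≤ Real.exp ((G' - G) / c i) * Real.exp (G / c i) := by gcongr
            _ = _ := by rw [← Real.exp_add]; ring_nf
  rw [hF, EReal.coe_le_coe_iff] at hle
  linarith

lemma LegendreEE_le_l0fun (hc : ∀ i, 0 < c i) (x : ℝ) :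
    LegendreEE (genLogMGF lf μ c) (x : EReal) ≤ l0fun lf μ c x := by
  refine iSup_le fun t => ?_
  rw [l0fun, EReal.le_neg]
  refine EReal.le_of_forall_lt_iff_le.1 fun z hz => ?_
  have hA : genLogMGF lf μ c t < ((z + t * x : ℝ) : EReal) := by
    revert hz
    rw [← EReal.coe_mul]
    induction genLogMGF lf μ c t with
    | bot => intro _; exact EReal.bot_lt_coe _
    | top => intro h; simp at h
    | coe r =>
      norm_cast
      intro h
      linarith
  obtain ⟨A, hA1, hA2⟩ := EReal.lt_iff_exists_real_btwn.1 hA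
  rw [EReal.coe_lt_coe_iff] at hA2
  have hδ : 0 < (z + t * x - A) / (|t| + 1) := div_pos (by linarith) (by positivity)
  refine (iInf₂_le _ hδ).trans ((limsup_elog_Ioo_le hc hA1).trans ?_)
  rw [EReal.coe_le_coe_iff]
  have h1 : (|t| + 1) * ((z + t * x - A) / (|t| + 1)) = z + t * x - A := by field_simp
  nlinarith

lemma l0fun_le_LegendreEE [lf.NeBot] (hc : ∀ i, 0 < c i) (hc0 : Tendsto c lf (𝓝 0)) {x T : ℝ}
    (hT : 0 ≤ T)
    (h : ∀ δ > 0, ∃ t ∈ Icc 0 T, ∃ F s₁ s₂ : ℝ, genLogMGF lf μ c t = (F : EReal) ∧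
      t < s₁ ∧ genLogMGF lf μ c s₁ < ((F + (s₁ - t) * (x + δ) : ℝ) : EReal) ∧
      s₂ < t ∧ genLogMGF lf μ c s₂ < ((F - (t - s₂) * (x - δ) : ℝ) : EReal)) :
    l0fun lf μ c x ≤ LegendreEE (genLogMGF lf μ c) (x : EReal) := by
  rw [l0fun, EReal.neg_le]
  refine le_iInf₂ fun ε (hε : 0 < ε) => ?_
  refine EReal.ge_of_forall_gt_iff_ge.1 fun z hz => ?_
  obtain ⟨w, hzw, hw⟩ := EReal.lt_iff_exists_real_btwn.1 hz
  rw [EReal.coe_lt_coe_iff] at hzw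
  set δ := min ε ((w - z) / (T + 1)) with hδ
  have hδ0 : 0 < δ := lt_min hε (div_pos (by linarith) (by linarith))
  obtain ⟨t, ht, F, s₁, s₂, hF, hs₁, hL₁, hs₂, hL₂⟩ := h δ hδ0
  have hmono : limsup (fun i => elog (c i) (μ i (Ioo (x - δ) (x + δ)))) lf
      ≤ limsup (fun i => elog (c i) (μ i (Ioo (x - ε) (x + ε)))) lf := by
    refine limsup_le_limsup (Eventually.of_forall fun i => ?_)
    have hδε : δ ≤ ε := min_le_left _ _
    exact mul_le_mul_of_nonneg_left (ENNReal.log_monotone (measure_mono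
      (Ioo_subset_Ioo (by linarith) (by linarith)))) (by exact_mod_cast (hc i).le)
  refine le_trans ?_ ((le_limsup_elog_Ioo hc hc0 ht.1 hF hs₁ hL₁ hs₂ hL₂).trans hmono)
  have hLeg : ((t * x - F : ℝ) : EReal) ≤ LegendreEE (genLogMGF lf μ c) (x : EReal) := by
    refine le_trans (le_of_eq ?_) (le_iSup _ t)
    rw [hF]; norm_cast
  have hw' : w < F - t * x := by
    have := hw.trans_le (EReal.neg_le_neg_iff.2 hLeg)
    norm_cast at this
    linarith
  rw [EReal.coe_le_coe_iff]
  have h1 : (T + 1) * δ ≤ w - z := by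
    have := min_le_right ε ((w - z) / (T + 1))
    rw [← hδ, le_div_iff₀ (by linarith)] at this
    linarith
  nlinarith [mul_le_mul_of_nonneg_right ht.2 hδ0.le]

end Limsup

lemma coe_le_rightDerivE_iff {L : ℝ → EReal} {t F : ℝ} (hF : L t = (F : EReal))
    (hbot : ∀ s, t < s → L s ≠ ⊥) (y : ℝ) :
    (y : EReal) ≤ rightDerivE L t ↔ ∀ s, t < s → ((F + y * (s - t) : ℝ) : EReal) ≤ L s := by
  rw [rightDerivE]
  split_ifs with h1 h2
  · simp only [le_top, true_iff]
    intro s hs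
    rw [h1 s hs]
    exact le_top
  · obtain ⟨s, hs, hs'⟩ := h2
    exact absurd hs' (hbot s hs)
  · rw [le_iInf₂_iff]
    refine forall₂_congr fun s (hs : t < s) => ?_
    have hst : 0 < s - t := sub_pos.2 hs
    rw [hF]
    have hb := hbot s hs
    induction hLs : L s with
    | bot => exact absurd hLs hb
    | top => simp [EReal.top_mul_coe_of_pos (inv_pos.2 hst)]
    | coe r =>
      norm_cast
      rw [← div_eq_mul_inv, le_div_iff₀ hst]
      constructor <;> intro <;> linarith

lemma exists_lt_of_rightDerivE_lt {L : ℝ → EReal} {t F y : ℝ} (hF : L t = (F : EReal))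
    (hbot : ∀ s, t < s → L s ≠ ⊥) (h : rightDerivE L t < (y : EReal)) :
    ∃ s, t < s ∧ L s < ((F + y * (s - t) : ℝ) : EReal) := by
  simpa using (coe_le_rightDerivE_iff hF hbot y).not.1 (not_le.2 h)

lemma slope_le_rightDerivE_genLogMGF {ι : Type*} {lf : Filter ι} {μ : ι → Measure ℝ} {c : ι → ℝ}
    (hc : ∀ i, 0 < c i) {a b A B : ℝ} (hab : a < b) (hA : genLogMGF lf μ c a = (A : EReal))
    (hB : genLogMGF lf μ c b = (B : EReal)) (hbot : ∀ s, b < s → genLogMGF lf μ c s ≠ ⊥) :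
    (((B - A) / (b - a) : ℝ) : EReal) ≤ rightDerivE (genLogMGF lf μ c) b := by
  rw [coe_le_rightDerivE_iff hB hbot]
  intro s hs
  have hb := hbot s hs
  induction hD : genLogMGF lf μ c s with
  | bot => exact absurd hD hb
  | top => exact le_top
  | coe D =>
    have h := genLogMGF_le_chord hc hab hs hA.le hD.le
    rw [hB, EReal.coe_le_coe_iff, le_div_iff₀ (by linarith)] at h
    rw [EReal.coe_le_coe_iff, div_mul_eq_mul_div, ← le_sub_iff_add_le',
      div_le_iff₀ (by linarith)]
    nlinarith

theorem statement14
    {ι : Type*} (lf : Filter ι) [lf.NeBot]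
    (μ : ι → Measure ℝ) [∀ i, IsProbabilityMeasure (μ i)]
    (c : ι → ℝ) (hc : ∀ i, 0 < c i) (hc0 : Filter.Tendsto c lf (nhds (0 : ℝ)))
    (L : ℝ → EReal) (hL : L = genLogMGF lf μ c)
    (lam : ℝ) (hlam : 0 ≤ lam) (hp : LbarProper L)
    (hfin : ∃ t : ℝ, lam < t ∧ L t ≠ ⊤) :
    (∃ e : ℝ, 0 < e ∧ ∀ t ∈ Set.Ioo lam (lam + e),
      ∃ r : ℝ, rightDerivE L t = (r : EReal) ∧
        l0fun lf μ c r = LegendreEE L ((r : ℝ) : EReal)) ∧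
    (rightLimE (rightDerivE L) lam ≠ ⊥ →
      ∃ r : ℝ, rightLimE (rightDerivE L) lam = (r : EReal) ∧ l0fun lf μ c r = LegendreEE L ((r : ℝ) : EReal)) := by
  subst hL
  obtain ⟨T, hlT, hTtop⟩ := hfin
  have hT : 0 < T := hlam.trans_lt hlT
  have hbot : ∀ t, 0 ≤ t → ∀ s, t < s → genLogMGF lf μ c s ≠ ⊥ :=
    fun t ht s hs => hp.1 s (ht.trans hs.le)
  have h0 : genLogMGF lf μ c 0 = ((0 : ℝ) : EReal) := genLogMGF_zero
  obtain ⟨D, hD⟩ : ∃ D : ℝ, genLogMGF lf μ c T = (D : EReal) :=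
    ⟨_, (EReal.coe_toReal hTtop (hp.1 T hT.le)).symm⟩
  have hreal : ∀ t, 0 < t → t < T → ∃ F : ℝ, genLogMGF lf μ c t = (F : EReal) := fun t ht htT =>
    ⟨_, (EReal.coe_toReal ((genLogMGF_le_chord hc ht htT h0.le hD.le).trans_lt
      (EReal.coe_lt_top _)).ne (hp.1 t ht.le)).symm⟩
  have hderiv : ∀ t, 0 < t → t < T →
      ∃ r : ℝ, rightDerivE (genLogMGF lf μ c) t = (r : EReal) := by
    intro t ht htT
    obtain ⟨F, hF⟩ := hreal t ht htT
    refine ⟨_, (EReal.coe_toReal (fun htop => ?_) (ne_bot_of_le_ne_bot (EReal.coe_ne_bot _)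
      (slope_le_rightDerivE_genLogMGF hc ht h0 hF (hbot t ht.le)))).symm⟩
    have h := (coe_le_rightDerivE_iff hF (hbot t ht.le) ((D - F + 1) / (T - t))).1
      (htop ▸ le_top) T htT
    rw [hD, EReal.coe_le_coe_iff, div_mul_cancel₀ _ (by linarith)] at h
    linarith
  refine ⟨⟨T - lam, by linarith, fun t ht => ?_⟩, fun hne => ?_⟩
  · have ht0 : 0 < t := hlam.trans_lt ht.1
    have htT : t < T := by linarith [ht.2]
    obtain ⟨F, hF⟩ := hreal t ht0 htT
    obtain ⟨r, hr⟩ := hderiv t ht0 htT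
    refine ⟨r, hr, le_antisymm (l0fun_le_LegendreEE hc hc0 hT.le fun δ hδ => ?_)
      (LegendreEE_le_l0fun hc r)⟩
    have hge := (coe_le_rightDerivE_iff hF (hbot t ht0.le) r).1 hr.ge
    obtain ⟨s, hts, hs⟩ := exists_lt_of_rightDerivE_lt hF (hbot t ht0.le)
      (hr.trans_lt (EReal.coe_lt_coe_iff.2 (lt_add_of_pos_right r hδ)))
    obtain ⟨q, hsq, hq⟩ := EReal.lt_iff_exists_real_btwn.1 hs
    rw [EReal.coe_lt_coe_iff] at hq
    obtain ⟨u, htu, hu⟩ : ∃ u, t < u ∧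
        u < min (min s T) (t + (F + (r + δ) * (s - t) - q) / δ) :=
      exists_between (lt_min (lt_min hts htT) (by
        have := div_pos (sub_pos.2 hq) hδ
        linarith))
    obtain ⟨hu', huq⟩ := lt_min_iff.1 hu
    obtain ⟨hus, huT⟩ := lt_min_iff.1 hu'
    rw [← sub_lt_iff_lt_add', lt_div_iff₀ hδ] at huq
    obtain ⟨U, hU⟩ := hreal u (ht0.trans htu) huT
    have hFU := hge u htu
    rw [hU, EReal.coe_le_coe_iff] at hFU
    refine ⟨u, ⟨(ht0.trans htu).le, huT.le⟩, U, s, t, hU, hus,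
      hsq.trans (EReal.coe_lt_coe_iff.2 ?_), htu, ?_⟩
    · nlinarith
    · rw [hF, EReal.coe_lt_coe_iff]
      nlinarith [mul_pos (sub_pos.2 htu) hδ]
  · set x := rightLimE (rightDerivE (genLogMGF lf μ c)) lam
    have hle : ∀ t, lam < t → t < T → x ≤ rightDerivE (genLogMGF lf μ c) t := by
      intro t hlt htT
      refine limsup_le_of_le (h := ?_)
      filter_upwards [Ioo_mem_nhdsGT hlt] with s hs
      have hs0 : 0 < s := hlam.trans_lt hs.1
      obtain ⟨S, hS⟩ := hreal s hs0 (hs.2.trans htT)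
      obtain ⟨F, hF⟩ := hreal t (hs0.trans hs.2) htT
      obtain ⟨r, hr⟩ := hderiv s hs0 (hs.2.trans htT)
      refine le_trans ?_ (slope_le_rightDerivE_genLogMGF hc hs.2 hS hF
        (hbot t (hs0.trans hs.2).le))
      have h := (coe_le_rightDerivE_iff hS (hbot s hs0.le) r).1 hr.ge t hs.2
      rw [hF, EReal.coe_le_coe_iff] at h
      rw [hr, EReal.coe_le_coe_iff, le_div_iff₀ (sub_pos.2 hs.2)]
      linarith
    have htop : x ≠ ⊤ := by
      obtain ⟨t, hlt, htT⟩ := exists_between hlT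
      obtain ⟨r, hr⟩ := hderiv t (hlam.trans_lt hlt) htT
      exact ne_top_of_le_ne_top (EReal.coe_ne_top r) (hr ▸ hle t hlt htT)
    obtain ⟨r, hr⟩ : ∃ r : ℝ, x = (r : EReal) := ⟨_, (EReal.coe_toReal htop hne).symm⟩
    refine ⟨r, hr, le_antisymm (l0fun_le_LegendreEE hc hc0 hT.le fun δ hδ => ?_)
      (LegendreEE_le_l0fun hc r)⟩
    have hev : ∀ᶠ t in 𝓝[>] lam, rightDerivE (genLogMGF lf μ c) t < ((r + δ : ℝ) : EReal) :=
      eventually_lt_of_limsup_lt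
        (hr.trans_lt (EReal.coe_lt_coe_iff.2 (lt_add_of_pos_right r hδ)))
    obtain ⟨t, htd, hlt, htT⟩ := (hev.and (Ioo_mem_nhdsGT hlT)).exists
    have ht0 : 0 < t := hlam.trans_lt hlt
    obtain ⟨F, hF⟩ := hreal t ht0 htT
    obtain ⟨s₁, hts, hs₁⟩ := exists_lt_of_rightDerivE_lt hF (hbot t ht0.le) htd
    obtain ⟨s₂, hls, hst⟩ := exists_between hlt
    have hs0 : 0 < s₂ := hlam.trans_lt hls
    obtain ⟨S, hS⟩ := hreal s₂ hs0 (hst.trans htT)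
    refine ⟨t, ⟨ht0.le, htT.le⟩, F, s₁, s₂, hF, hts, by rwa [mul_comm (s₁ - t)], hst, ?_⟩
    have h := (coe_le_rightDerivE_iff hS (hbot s₂ hs0.le) r).1
      (hr ▸ hle s₂ hls (hst.trans htT)) t hst
    rw [hF, EReal.coe_le_coe_iff] at h
    rw [hS, EReal.coe_lt_coe_iff]
    nlinarith [mul_pos (sub_pos.2 hst) hδ]
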